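/- In the bigraded setup below, assume in addition that f_1,…,f_k form a regular sequence in ℂ[z_1,…,z_{N+k+1}], and set i(X) = N+k+1 − (d_1+…+d_k). If i(X) ≥ 2, then dim_ℂ R_{1,−i(X)} = ∑_{j=1}^{k} ∑_{I⊆{1,…,k}} (−1)^{k−|I|} C((∑_{s∈I} d_s) + d_j − 1, N+k). -/

import Mathlib

open MvPolynomial

noncomputable section

/-- The polynomial ring `S = ℂ[z_1,…,z_{N+k+1}, w_1,…,w_k]`. -/
abbrev SRing (N k : ℕ) : Type := MvPolynomial (Fin (N + k + 1) ⊕ Fin k) ℂ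

/-- The bigrading on `S`: `deg z_s = (0,1)` and `deg w_j = (1, -d_j)`. -/
def wt (N k : ℕ) (d : Fin k → ℕ) : Fin (N + k + 1) ⊕ Fin k → ℤ × ℤ :=
  Sum.elim (fun _ => ((0 : ℤ), (1 : ℤ))) (fun j => ((1 : ℤ), -(d j : ℤ)))

/-- `F = w_1 f_1 + ⋯ + w_k f_k ∈ S`. -/
def bigF (N k : ℕ) (f : Fin k → MvPolynomial (Fin (N + k + 1)) ℂ) : SRing N k :=
  ∑ j : Fin k, X (Sum.inr j) * rename Sum.inl (f j)

/-- The ideal `J(F)` generated by all the partial derivatives of `F`. -/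
def Jfull (N k : ℕ) (f : Fin k → MvPolynomial (Fin (N + k + 1)) ℂ) : Ideal (SRing N k) :=
  Ideal.span (Set.range fun v : Fin (N + k + 1) ⊕ Fin k => pderiv v (bigF N k f))

/-- The ideal `J'(F)` generated by `∂F/∂w_1, …, ∂F/∂w_k` alone. -/
def Jprime (N k : ℕ) (f : Fin k → MvPolynomial (Fin (N + k + 1)) ℂ) : Ideal (SRing N k) :=
  Ideal.span (Set.range fun j : Fin k => pderiv (Sum.inr j) (bigF N k f))

lemma Jprime_le_Jfull (N k : ℕ) (f : Fin k → MvPolynomial (Fin (N + k + 1)) ℂ) :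
    Jprime N k f ≤ Jfull N k f :=
  Ideal.span_mono (by rintro x ⟨j, rfl⟩; exact ⟨Sum.inr j, rfl⟩)

/-- The bidegree-`(p,q)` component of `S`. -/
def Scomp (N k : ℕ) (d : Fin k → ℕ) (p q : ℤ) : Submodule ℂ (SRing N k) :=
  weightedHomogeneousSubmodule ℂ (wt N k d) (p, q)

/-- The bidegree-`(p,q)` component of `R = S/J(F)`. -/
def Rcomp (N k : ℕ) (d : Fin k → ℕ) (f : Fin k → MvPolynomial (Fin (N + k + 1)) ℂ)
    (p q : ℤ) : Submodule ℂ (SRing N k ⧸ Jfull N k f) :=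
  Submodule.map (Ideal.Quotient.mkₐ ℂ (Jfull N k f)).toLinearMap (Scomp N k d p q)

/-- The bidegree-`(p,q)` component of `R' = S/J'(F)`. -/
def R'comp (N k : ℕ) (d : Fin k → ℕ) (f : Fin k → MvPolynomial (Fin (N + k + 1)) ℂ)
    (p q : ℤ) : Submodule ℂ (SRing N k ⧸ Jprime N k f) :=
  Submodule.map (Ideal.Quotient.mkₐ ℂ (Jprime N k f)).toLinearMap (Scomp N k d p q)

/-- `f 0, …, f (k-1)` is a regular sequence: each `f i` is a nonzerodivisor modulo the
ideal generated by the previous ones. -/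
def IsRegularSeq {m k : ℕ} (f : Fin k → MvPolynomial (Fin m) ℂ) : Prop :=
  ∀ i : Fin k, ∀ p : MvPolynomial (Fin m) ℂ,
    f i * p ∈ Ideal.span (f '' {j : Fin k | j < i}) →
      p ∈ Ideal.span (f '' {j : Fin k | j < i})

/-- The polynomials in `r + 1` variables that are homogeneous of degree `m : ℤ`. -/
abbrev intHomogeneous (r : ℕ) (m : ℤ) : Submodule ℂ (MvPolynomial (Fin (r + 1)) ℂ) :=
  weightedHomogeneousSubmodule ℂ (fun _ => (1 : ℤ)) m

lemma weight_one_int_eq {r : ℕ} (e : Fin (r + 1) →₀ ℕ) :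
    Finsupp.weight (fun _ => (1 : ℤ)) e = ((∑ i, e i : ℕ) : ℤ) := by
  simp [Finsupp.weight_apply, Finsupp.sum_fintype]

lemma isWeightedHomogeneous_one_int {r n : ℕ} {p : MvPolynomial (Fin (r + 1)) ℂ}
    (hp : p.IsHomogeneous n) : p.IsWeightedHomogeneous (fun _ => (1 : ℤ)) (n : ℤ) := by
  intro e he
  rw [weight_one_int_eq, ← hp he]
  simp [Finsupp.weight_apply, Finsupp.sum_fintype]

lemma intHomogeneous_eq_supported (r : ℕ) (m : ℤ) :
    intHomogeneous r m = AddMonoidAlgebra.supported ℂ ℂ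
      ((if 0 ≤ m then (Finset.univ : Finset (Fin (r + 1))).finsuppAntidiag m.toNat else ∅ :
        Finset (Fin (r + 1) →₀ ℕ)) : Set (Fin (r + 1) →₀ ℕ)) := by
  rw [intHomogeneous, weightedHomogeneousSubmodule_eq_finsupp_supported]
  congr 1
  ext e
  split_ifs with h
  · simp only [Set.mem_ofPred_eq, weight_one_int_eq, Finset.mem_coe, Finset.mem_finsuppAntidiag,
      Finset.subset_univ, and_true]
    change _ ↔ ∑ i, e i = _
    omega
  · simp only [Set.mem_ofPred_eq, weight_one_int_eq, Finset.coe_empty, Set.mem_empty_iff_false,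
      iff_false]
    omega

instance intHomogeneous_finite (r : ℕ) (m : ℤ) : Module.Finite ℂ (intHomogeneous r m) := by
  rw [intHomogeneous_eq_supported]
  exact Module.Finite.equiv (AddMonoidAlgebra.supportedEquivFinsupp _).symm

lemma finrank_intHomogeneous {r : ℕ} (hr : 1 ≤ r) (m : ℤ) :
    Module.finrank ℂ (intHomogeneous r m) = Nat.choose (m + r).toNat r := by
  rw [intHomogeneous_eq_supported, (AddMonoidAlgebra.supportedEquivFinsupp _).finrank_eq,
    Module.finrank_finsupp_self]
  simp only [Finset.coe_sort_coe, Fintype.card_coe]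
  split_ifs with h
  · rw [Finset.card_finsuppAntidiag_nat_eq_choose, Finset.card_univ, Fintype.card_fin]
    lift m to ℕ using h
    rw [show r + 1 + (m : ℤ).toNat - 1 = m + r by omega,
      show ((m : ℤ) + r).toNat = m + r by omega, Int.toNat_natCast, Nat.choose_symm_add]
  · rw [Nat.choose_eq_zero_of_lt (by omega), Finset.card_empty]

attribute [local instance] MvPolynomial.weightedGradedAlgebra

/-- The Hilbert function of the quotient by `I`, evaluated at `m`. -/
def hilb (r : ℕ) (I : Ideal (MvPolynomial (Fin (r + 1)) ℂ)) (m : ℤ) : ℕ :=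
  Module.finrank ℂ (intHomogeneous r m ⧸
    (I.restrictScalars ℂ).comap (intHomogeneous r m).subtype)

lemma hilb_add_finrank_inf (r : ℕ) (I : Ideal (MvPolynomial (Fin (r + 1)) ℂ)) (m : ℤ) :
    hilb r I m + Module.finrank ℂ ↥(intHomogeneous r m ⊓ I.restrictScalars ℂ) =
      Module.finrank ℂ (intHomogeneous r m) := by
  rw [hilb, ← Submodule.finrank_quotient_add_finrank
    ((I.restrictScalars ℂ).comap (intHomogeneous r m).subtype),
    ← Submodule.map_comap_subtype, LinearEquiv.finrank_eq
    (Submodule.equivMapOfInjective _ (intHomogeneous r m).injective_subtype _)]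

lemma intHomogeneous_inf_sup_span_singleton {r : ℕ} {I : Ideal (MvPolynomial (Fin (r + 1)) ℂ)}
    (hI : I.IsHomogeneous (intHomogeneous r)) {g : MvPolynomial (Fin (r + 1)) ℂ} {c : ℤ}
    (hg : g ∈ intHomogeneous r c) (m : ℤ) :
    intHomogeneous r m ⊓ (I ⊔ Ideal.span {g}).restrictScalars ℂ =
      (intHomogeneous r m ⊓ I.restrictScalars ℂ) ⊔
        (intHomogeneous r (m - c)).map (LinearMap.mulLeft ℂ g) := by
  apply le_antisymm
  · rintro x ⟨hx, hx'⟩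
    obtain ⟨a, ha, b, hb, rfl⟩ := Submodule.mem_sup.1 hx'
    obtain ⟨b, rfl⟩ := Ideal.mem_span_singleton'.1 hb
    have h := DirectSum.decompose_of_mem_same (intHomogeneous r) hx
    have h2 := DirectSum.coe_decompose_mul_add_of_left_mem (intHomogeneous r) (j := m - c)
      hg (b := b)
    rw [add_sub_cancel] at h2
    rw [mul_comm b g] at h ⊢
    rw [DirectSum.decompose_add, DirectSum.add_apply, Submodule.coe_add, h2] at h
    rw [← h]
    exact Submodule.add_mem_sup ⟨SetLike.coe_mem _, hI m ha⟩ ⟨_, SetLike.coe_mem _, rfl⟩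
  · apply sup_le
    · exact inf_le_inf_left _ (fun x hx => Ideal.mem_sup_left hx)
    · rintro _ ⟨b, hb, rfl⟩
      refine ⟨?_, Ideal.mem_sup_right (Ideal.mul_mem_right _ _ (Ideal.mem_span_singleton_self g))⟩
      have := IsWeightedHomogeneous.mul (show IsWeightedHomogeneous _ g c from hg)
        (show IsWeightedHomogeneous _ b (m - c) from hb)
      rwa [add_sub_cancel] at this

lemma hilb_sup_span_singleton {r : ℕ} {I : Ideal (MvPolynomial (Fin (r + 1)) ℂ)}
    (hI : I.IsHomogeneous (intHomogeneous r)) {g : MvPolynomial (Fin (r + 1)) ℂ} {c : ℤ}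
    (hg : g ∈ intHomogeneous r c) (hreg : ∀ p, g * p ∈ I → p ∈ I) (m : ℤ) :
    (hilb r (I ⊔ Ideal.span {g}) m : ℤ) = hilb r I m - hilb r I (m - c) := by
  have h1 := hilb_add_finrank_inf r I m
  have h2 := hilb_add_finrank_inf r I (m - c)
  have h3 := hilb_add_finrank_inf r (I ⊔ Ideal.span {g}) m
  by_cases h0 : g = 0
  · have : I = ⊤ := (Ideal.eq_top_iff_one _).2 (hreg 1 (by simp [h0]))
    subst this
    have : intHomogeneous r (m - c) ⊓ (⊤ : Ideal (MvPolynomial (Fin (r + 1)) ℂ)).restrictScalars ℂ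
      = intHomogeneous r (m - c) := by simp
    rw [this] at h2
    rw [top_sup_eq]
    omega
  have hinj : Function.Injective (LinearMap.mulLeft ℂ g) := by
    intro a b hab
    exact mul_left_cancel₀ h0 hab
  have h4 := Submodule.finrank_sup_add_finrank_inf_eq (intHomogeneous r m ⊓ I.restrictScalars ℂ)
    ((intHomogeneous r (m - c)).map (LinearMap.mulLeft ℂ g))
  have h5 : intHomogeneous r m ⊓ I.restrictScalars ℂ ⊓
      (intHomogeneous r (m - c)).map (LinearMap.mulLeft ℂ g) =
      (intHomogeneous r (m - c) ⊓ I.restrictScalars ℂ).map (LinearMap.mulLeft ℂ g) := by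
    apply le_antisymm
    · rintro _ ⟨⟨-, hx⟩, b, hb, rfl⟩
      exact ⟨b, ⟨hb, hreg b hx⟩, rfl⟩
    · rintro _ ⟨b, ⟨hb, hb'⟩, rfl⟩
      refine ⟨⟨?_, Ideal.mul_mem_left _ _ hb'⟩, b, hb, rfl⟩
      have := IsWeightedHomogeneous.mul (show IsWeightedHomogeneous _ g c from hg)
        (show IsWeightedHomogeneous _ b (m - c) from hb)
      rwa [add_sub_cancel] at this
  rw [← intHomogeneous_inf_sup_span_singleton hI hg, h5,
    ← (Submodule.equivMapOfInjective _ hinj _).finrank_eq,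
    ← (Submodule.equivMapOfInjective _ hinj _).finrank_eq] at h4
  omega

lemma hilb_bot {r : ℕ} (hr : 1 ≤ r) (m : ℤ) : hilb r ⊥ m = Nat.choose (m + r).toNat r := by
  have h := hilb_add_finrank_inf r ⊥ m
  have : intHomogeneous r m ⊓ (⊥ : Ideal (MvPolynomial (Fin (r + 1)) ℂ)).restrictScalars ℂ = ⊥ := by
    simp
  rw [this, finrank_bot, add_zero, finrank_intHomogeneous hr] at h
  exact h

lemma hilb_initial_span {r k : ℕ} (hr : 1 ≤ r) {d : Fin k → ℕ}
    {f : Fin k → MvPolynomial (Fin (r + 1)) ℂ}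
    (hf : ∀ j, (f j).IsHomogeneous (d j)) (hreg : IsRegularSeq f) (i : ℕ) (hi : i ≤ k) (m : ℤ) :
    (hilb r (Ideal.span (f '' {j | (j : ℕ) < i})) m : ℤ) =
      ∑ I ∈ (Finset.univ.filter fun j : Fin k => (j : ℕ) < i).powerset,
        (-1) ^ I.card * (Nat.choose (m - (∑ s ∈ I, d s : ℕ) + r).toNat r : ℤ) := by
  induction i generalizing m with
  | zero => simp [hilb_bot hr]
  | succ i ih =>
    let a : Fin k := ⟨i, hi⟩
    have e1 : {j : Fin k | (j : ℕ) < i + 1} = insert a {j : Fin k | (j : ℕ) < i} := by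
      ext j; simp [a, Fin.ext_iff]; omega
    have e2 : (Finset.univ.filter fun j : Fin k => (j : ℕ) < i + 1) =
        insert a (Finset.univ.filter fun j : Fin k => (j : ℕ) < i) := by
      ext j; simp [a, Fin.ext_iff]; omega
    have hhom : ∀ j, f j ∈ intHomogeneous r (d j) := fun j => isWeightedHomogeneous_one_int (hf j)
    have ha : a ∉ Finset.univ.filter fun j : Fin k => (j : ℕ) < i := by simp [a]
    have hra : ∀ p, f a * p ∈ Ideal.span (f '' {j | (j : ℕ) < i}) →
        p ∈ Ideal.span (f '' {j | (j : ℕ) < i}) := hreg a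
    rw [e1, e2, Set.image_insert_eq, Set.insert_eq, Set.union_comm, Ideal.span_union,
      hilb_sup_span_singleton (c := d a) ?_ (hhom a) hra, ih (by omega), ih (by omega),
      Finset.sum_powerset_insert ha, sub_eq_add_neg, ← Finset.sum_neg_distrib]
    · congr 1
      refine Finset.sum_congr rfl fun I hI => ?_
      have haI : a ∉ I := fun h => ha (Finset.mem_powerset.1 hI h)
      rw [Finset.card_insert_of_notMem haI, Finset.sum_insert haI, pow_succ]
      push_cast
      rw [sub_sub]
      ring
    · refine Ideal.homogeneous_span _ _ ?_
      rintro _ ⟨j, -, rfl⟩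
      exact ⟨_, hhom j⟩

lemma hilb_span_range {r k : ℕ} (hr : 1 ≤ r) {d : Fin k → ℕ}
    {f : Fin k → MvPolynomial (Fin (r + 1)) ℂ}
    (hf : ∀ j, (f j).IsHomogeneous (d j)) (hreg : IsRegularSeq f) (m : ℤ) :
    (hilb r (Ideal.span (Set.range f)) m : ℤ) =
      ∑ I ∈ (Finset.univ : Finset (Fin k)).powerset,
        (-1) ^ I.card * (Nat.choose (m - (∑ s ∈ I, d s : ℕ) + r).toNat r : ℤ) := by
  simpa using hilb_initial_span hr hf hreg k le_rfl m

section Bigraded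

variable {N k : ℕ} {d : Fin k → ℕ} {f : Fin k → MvPolynomial (Fin (N + k + 1)) ℂ}

lemma weight_wt_eq (e : Fin (N + k + 1) ⊕ Fin k →₀ ℕ) :
    Finsupp.weight (wt N k d) e = (((∑ j, e (Sum.inr j) : ℕ) : ℤ),
      ((∑ s, e (Sum.inl s) : ℕ) : ℤ) - ((∑ j, e (Sum.inr j) * d j : ℕ) : ℤ)) := by
  rw [Finsupp.weight_apply, Finsupp.sum_fintype _ _ (by simp), Fintype.sum_sum_type]
  ext <;> simp [wt, Prod.fst_sum, Prod.snd_sum, sub_eq_add_neg]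

lemma rename_inl_mem_Scomp {m : ℤ} {p : MvPolynomial (Fin (N + k + 1)) ℂ}
    (hp : p ∈ intHomogeneous (N + k) m) : rename Sum.inl p ∈ Scomp N k d 0 m := by
  intro e he
  obtain ⟨u, rfl, hu⟩ := coeff_rename_ne_zero _ _ _ he
  have h := hp hu
  rw [weight_one_int_eq] at h
  rw [weight_wt_eq]
  have h1 (j : Fin k) : u.mapDomain Sum.inl (Sum.inr j : Fin (N + k + 1) ⊕ Fin k) = 0 :=
    Finsupp.mapDomain_of_notMem_range _ _ (by simp)
  simp [h1, Finsupp.mapDomain_apply Sum.inl_injective, ← h]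

lemma X_inr_mem_Scomp (j : Fin k) : (X (Sum.inr j) : SRing N k) ∈ Scomp N k d 1 (-(d j)) :=
  isWeightedHomogeneous_X ℂ (wt N k d) (Sum.inr j)

lemma mul_mem_Scomp {a b a' b' : ℤ} {x y : SRing N k} (hx : x ∈ Scomp N k d a b)
    (hy : y ∈ Scomp N k d a' b') : x * y ∈ Scomp N k d (a + a') (b + b') :=
  IsWeightedHomogeneous.mul (show IsWeightedHomogeneous (wt N k d) x (a, b) from hx)
    (show IsWeightedHomogeneous (wt N k d) y (a', b') from hy)

variable (N k) in
/-- The map `(p_j) ↦ ∑ w_j p_j`. -/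
def linearInW : (Fin k → MvPolynomial (Fin (N + k + 1)) ℂ) →ₗ[ℂ] SRing N k :=
  ∑ j, LinearMap.mulLeft ℂ (X (Sum.inr j)) ∘ₗ (rename Sum.inl).toLinearMap ∘ₗ LinearMap.proj j

lemma linearInW_apply (p : Fin k → MvPolynomial (Fin (N + k + 1)) ℂ) :
    linearInW N k p = ∑ j, X (Sum.inr j) * rename Sum.inl (p j) := by
  simp [linearInW]

lemma map_linearInW (q : ℤ) :
    (Submodule.pi Set.univ fun j => intHomogeneous (N + k) (d j + q)).map (linearInW N k) =
      Scomp N k d 1 q := by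
  apply le_antisymm
  · rintro _ ⟨p, hp, rfl⟩
    rw [linearInW_apply]
    refine Submodule.sum_mem _ fun j _ => ?_
    have := mul_mem_Scomp (X_inr_mem_Scomp (d := d) j) (rename_inl_mem_Scomp (hp j trivial))
    simpa using this
  · rw [Scomp, weightedHomogeneousSubmodule_eq_finsupp_supported,
      AddMonoidAlgebra.supported_eq_span_single, Submodule.span_le]
    rintro _ ⟨e, he, rfl⟩
    rw [Set.mem_ofPred_eq, weight_wt_eq, Prod.mk.injEq] at he
    obtain ⟨h1, h2⟩ := he
    have h1 : ∑ j, e (Sum.inr j) = 1 := by exact_mod_cast h1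
    obtain ⟨j, hj⟩ : ∃ j, e (Sum.inr j) ≠ 0 := by
      by_contra! h
      simp [h] at h1
    have h3 : ∀ i, e (Sum.inr i) = if i = j then 1 else 0 := by
      have h4 := Finset.add_sum_erase _ (fun j => e (Sum.inr j)) (Finset.mem_univ j)
      have h5 : ∑ x ∈ Finset.univ.erase j, e (Sum.inr x) = 0 := by omega
      rw [Finset.sum_eq_zero_iff] at h5
      intro i
      split_ifs with hij
      · subst hij; omega
      · exact h5 i (by simp [hij])
    let u : Fin (N + k + 1) →₀ ℕ := Finsupp.equivFunOnFinite.symm fun s => e (Sum.inl s)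
    refine ⟨Pi.single j (monomial u 1), ?_, ?_⟩
    · intro i _
      by_cases hij : i = j
      · subst hij
        rw [Pi.single_eq_same]
        refine isWeightedHomogeneous_monomial _ _ _ ?_
        rw [weight_one_int_eq]
        simp [h3] at h2
        simp [u, ← h2]
      · rw [Pi.single_eq_of_ne hij]
        exact Submodule.zero_mem _
    · rw [linearInW_apply, Finset.sum_eq_single j (fun i _ hij => by simp [hij]) (by simp)]
      have hu : Finsupp.single (Sum.inr j) 1 + u.mapDomain Sum.inl = e := by
        ext (s | i)
        · simp [u, Finsupp.mapDomain_apply Sum.inl_injective]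
        · simp [h3, Finsupp.mapDomain_of_notMem_range, Finsupp.single_apply, eq_comm]
      rw [Pi.single_eq_same, rename_monomial, X, monomial_mul, mul_one, hu]
      rfl

lemma pderiv_inr_bigF (j : Fin k) : pderiv (Sum.inr j) (bigF N k f) = rename Sum.inl (f j) := by
  have h (i : Fin k) : pderiv (Sum.inr j) (rename Sum.inl (f i) : SRing N k) = 0 :=
    pderiv_eq_zero_of_notMem_vars fun h => by
      have := vars_rename _ _ h
      simp at this
  simp [bigF, h, pderiv_X, Pi.single_apply]

lemma bigF_mem_Scomp (hf : ∀ j, (f j).IsHomogeneous (d j)) : bigF N k f ∈ Scomp N k d 1 0 := by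
  refine Submodule.sum_mem _ fun j _ => ?_
  have := mul_mem_Scomp (X_inr_mem_Scomp (d := d) j)
    (rename_inl_mem_Scomp (isWeightedHomogeneous_one_int (hf j)))
  simpa using this

lemma Scomp_zero_neg {q : ℤ} (hq : q < 0) : Scomp N k d 0 q = ⊥ := by
  rw [eq_bot_iff]
  intro x hx
  rw [Submodule.mem_bot]
  refine IsWeightedHomogeneous.eq_zero_of_no_monomials hx fun e he => ?_
  rw [weight_wt_eq, Prod.mk.injEq] at he
  obtain ⟨h1, h2⟩ := he
  have h1 : ∑ j, e (Sum.inr j) = 0 := by exact_mod_cast h1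
  rw [Finset.sum_eq_zero_iff] at h1
  simp [h1] at h2
  have : (0 : ℤ) ≤ ∑ s, (e (Sum.inl s) : ℤ) := Finset.sum_nonneg fun _ _ => by positivity
  omega

lemma mem_Jprime_of_mem_Jfull (hf : ∀ j, (f j).IsHomogeneous (d j)) {q : ℤ} (hq : q < -1)
    {x : SRing N k} (hx : x ∈ Scomp N k d 1 q) (hJ : x ∈ Jfull N k f) : x ∈ Jprime N k f := by
  let A : ℤ × ℤ → Submodule ℂ (SRing N k) := weightedHomogeneousSubmodule ℂ (wt N k d)
  have hA : (Jprime N k f).IsHomogeneous A := by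
    refine Ideal.homogeneous_span _ _ ?_
    rintro _ ⟨j, rfl⟩
    refine ⟨(0, d j), ?_⟩
    simp only [pderiv_inr_bigF]
    exact rename_inl_mem_Scomp (isWeightedHomogeneous_one_int (hf j))
  obtain ⟨c, rfl⟩ := (Submodule.mem_span_range_iff_exists_fun _).1 hJ
  rw [Fintype.sum_sum_type] at hx ⊢
  have h := DirectSum.decompose_of_mem_same A hx
  have h0 (s : Fin (N + k + 1)) : (DirectSum.decompose A
      (c (Sum.inl s) • pderiv (Sum.inl s) (bigF N k f)) (1, q) : SRing N k) = 0 := by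
    have hs : pderiv (Sum.inl s) (bigF N k f) ∈ A (1, -1) :=
      IsWeightedHomogeneous.pderiv (bigF_mem_Scomp hf) (by simp [wt])
    have h1 := DirectSum.coe_decompose_mul_add_of_right_mem A (i := (0, q + 1))
      (a := c (Sum.inl s)) hs
    have h2 : (DirectSum.decompose A (c (Sum.inl s)) (0, q + 1) : SRing N k) ∈
      Scomp N k d 0 (q + 1) := SetLike.coe_mem _
    rw [Scomp_zero_neg (by omega), Submodule.mem_bot] at h2
    rw [h2, zero_mul] at h1
    rw [show ((0, q + 1) + (1, -1) : ℤ × ℤ) = (1, q) by simp] at h1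
    exact h1
  rw [DirectSum.decompose_add, DirectSum.add_apply, Submodule.coe_add, DirectSum.decompose_sum,
    DFinsupp.finsetSum_apply, AddSubmonoidClass.coe_finsetSum,
    Finset.sum_eq_zero fun s _ => h0 s, zero_add] at h
  rw [← h]
  refine hA _ (Ideal.sum_mem _ fun j _ => Ideal.mul_mem_left _ _ ?_)
  exact Ideal.subset_span ⟨j, rfl⟩

lemma linearInW_mem_Jprime_iff (p : Fin k → MvPolynomial (Fin (N + k + 1)) ℂ) :
    linearInW N k p ∈ Jprime N k f ↔ ∀ j, p j ∈ Ideal.span (Set.range f) := by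
  have hJ : Jprime N k f = (Ideal.span (Set.range f)).map (rename Sum.inl) := by
    rw [Ideal.map_span, ← Set.range_comp, Jprime]
    congr 2
    ext j : 1
    exact pderiv_inr_bigF j
  constructor
  · intro h j
    let φ : SRing N k →ₐ[ℂ] Polynomial (MvPolynomial (Fin (N + k + 1)) ℂ ⧸
        Ideal.span (Set.range f)) :=
      aeval (R := ℂ) (Sum.elim
        (fun s => Polynomial.C (Ideal.Quotient.mk (Ideal.span (Set.range f)) (X s)))
        (Pi.single j Polynomial.X))
    have hφ (g : MvPolynomial (Fin (N + k + 1)) ℂ) :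
        φ (rename Sum.inl g) = Polynomial.C (Ideal.Quotient.mk _ g) := by
      have : φ.comp (rename Sum.inl) =
          Polynomial.CAlgHom.comp (Ideal.Quotient.mkₐ ℂ (Ideal.span (Set.range f))) := by
        ext s : 1
        simp [φ]
      exact DFunLike.congr_fun this g
    have hle : Jprime N k f ≤ RingHom.ker φ := by
      rw [hJ, Ideal.map_le_iff_le_comap]
      intro g hg
      rw [Ideal.mem_comap, RingHom.mem_ker, hφ, Ideal.Quotient.eq_zero_iff_mem.2 hg, map_zero]
    have h1 := (RingHom.mem_ker).1 (hle h)
    have h2 (i : Fin k) : φ (X (Sum.inr i)) = if i = j then Polynomial.X else 0 := by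
      simp [φ, Pi.single_apply]
    rw [linearInW_apply, map_sum] at h1
    simp only [map_mul, hφ, h2, ite_mul, zero_mul, Finset.sum_ite_eq', Finset.mem_univ,
      if_true] at h1
    have h3 := congrArg (fun t => Polynomial.coeff t 1) h1
    simpa [Ideal.Quotient.eq_zero_iff_mem, Polynomial.coeff_X_mul] using h3
  · intro h
    rw [linearInW_apply, hJ]
    exact Ideal.sum_mem _ fun j _ => Ideal.mul_mem_left _ _ (Ideal.mem_map_of_mem _ (h j))

lemma finrank_Rcomp_eq_sum_hilb (hf : ∀ j, (f j).IsHomogeneous (d j)) {q : ℤ} (hq : q < -1) :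
    Module.finrank ℂ (Rcomp N k d f 1 q) =
      ∑ j, hilb (N + k) (Ideal.span (Set.range f)) (d j + q) := by
  let Φ : (∀ j, intHomogeneous (N + k) (d j + q)) →ₗ[ℂ] SRing N k ⧸ Jfull N k f :=
    (Ideal.Quotient.mkₐ ℂ (Jfull N k f)).toLinearMap ∘ₗ linearInW N k ∘ₗ
      LinearMap.pi fun j => (intHomogeneous (N + k) (d j + q)).subtype ∘ₗ LinearMap.proj j
  have hpi : LinearMap.range (LinearMap.pi fun j =>
      (intHomogeneous (N + k) (d j + q)).subtype ∘ₗ LinearMap.proj j) =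
      Submodule.pi Set.univ fun j => intHomogeneous (N + k) (d j + q) := by
    ext p
    constructor
    · rintro ⟨p, rfl⟩ j -
      exact (p j).2
    · intro hp
      exact ⟨fun j => ⟨p j, hp j trivial⟩, rfl⟩
  have hrange : LinearMap.range Φ = Rcomp N k d f 1 q := by
    rw [LinearMap.range_comp, LinearMap.range_comp, hpi, map_linearInW, Rcomp]
  have hker : LinearMap.ker Φ = Submodule.pi Set.univ fun j =>
      ((Ideal.span (Set.range f)).restrictScalars ℂ).comap
        (intHomogeneous (N + k) (d j + q)).subtype := by
    ext p
    have hmem : linearInW N k (fun j => (p j : MvPolynomial (Fin (N + k + 1)) ℂ)) ∈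
        Scomp N k d 1 q := by
      rw [← map_linearInW]
      exact ⟨_, fun j _ => (p j).2, rfl⟩
    have h1 : p ∈ LinearMap.ker Φ ↔
        linearInW N k (fun j => (p j : MvPolynomial (Fin (N + k + 1)) ℂ)) ∈ Jfull N k f :=
      Ideal.Quotient.eq_zero_iff_mem
    rw [h1, show _ ∈ Jfull N k f ↔ _ ∈ Jprime N k f from
      ⟨mem_Jprime_of_mem_Jfull hf hq hmem, fun h => Jprime_le_Jfull N k f h⟩,
      linearInW_mem_Jprime_iff]
    simp [Submodule.mem_pi]
  have hfree (j : Fin k) : Module.Free ℂ (intHomogeneous (N + k) (d j + q) ⧸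
      ((Ideal.span (Set.range f)).restrictScalars ℂ).comap
        (intHomogeneous (N + k) (d j + q)).subtype) := Module.Free.of_divisionRing ..
  rw [← hrange, ← Φ.quotKerEquivRange.finrank_eq, hker, (Submodule.quotientPi _).finrank_eq,
    Module.finrank_pi_fintype]
  rfl

end Bigraded

/-- **Proposition 3.5, first case.** If `f_1,…,f_k` is a regular sequence and
`i(X) = N+k+1-∑ d_j ≥ 2`, then
`dim_ℂ R_{1,-i(X)} = ∑_{j=1}^{k} ∑_{I⊆{1,…,k}} (-1)^{k-|I|} C((∑_{s∈I} d_s)+d_j-1, N+k)`. -/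
theorem finrank_Rcomp_eq (N k : ℕ) (hN : 1 ≤ N) (hk : 1 ≤ k)
    (d : Fin k → ℕ) (hd : ∀ j, 1 ≤ d j)
    (f : Fin k → MvPolynomial (Fin (N + k + 1)) ℂ)
    (hfhom : ∀ j, (f j).IsHomogeneous (d j))
    (hfreg : IsRegularSeq f)
    (hiX : 2 ≤ N + k + 1 - (∑ j : Fin k, d j)) :
    (Module.finrank ℂ
        (Rcomp N k d f 1 (-((N + k + 1 - (∑ j : Fin k, d j) : ℕ) : ℤ))) : ℤ)
      = ∑ j : Fin k, ∑ I ∈ (Finset.univ : Finset (Fin k)).powerset,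
          (-1 : ℤ) ^ (k - I.card) *
            Nat.choose ((∑ s ∈ I, d s) + d j - 1) (N + k) := by
  rw [finrank_Rcomp_eq_sum_hilb hfhom (by omega)]
  push_cast
  refine Finset.sum_congr rfl fun j _ => ?_
  rw [hilb_span_range (by omega) hfhom hfreg, Finset.powerset_univ]
  refine Finset.sum_equiv (compl_involutive.toPerm compl) (by simp) fun I _ => ?_
  have h1 := Finset.sum_add_sum_compl I d
  have h2 := Finset.card_add_card_compl I
  have h3 := hd j
  rw [Fintype.card_fin] at h2
  rw [Function.Involutive.coe_toPerm, show k - (Iᶜ).card = I.card by omega]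
  congr 3
  omega
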